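/- Let q = p^k be any prime power and let n ≥ 3 be a fixed integer. A function f : F_q → F_q preserves positivity on M_n(F_q) if and only if f is a positive multiple of a field automorphism of F_q, i.e., there exist c ∈ F_q^+ and an integer ℓ with 0 ≤ ℓ ≤ k−1 such that f(x) = c·x^{p^ℓ} for all x ∈ F_q. -/

import Mathlib

/-- An element of a field is *positive* if it is a nonzero square. -/
def IsPos {F : Type*} [Field F] (x : F) : Prop := ∃ y : F, y ≠ 0 ∧ y ^ 2 = x

/-- The `r`-th leading principal minor of a square matrix (the determinant of the
top-left `(r+1) × (r+1)` submatrix). -/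
def leadingMinor {F : Type*} [CommRing F] {n : ℕ} (A : Matrix (Fin n) (Fin n) F)
    (r : Fin n) : F :=
  (A.submatrix (Fin.castLE r.isLt) (Fin.castLE r.isLt)).det

/-- A matrix over a finite field is positive definite if it is symmetric and all its
leading principal minors are positive (nonzero squares). -/
def IsPosDef {F : Type*} [Field F] {n : ℕ} (A : Matrix (Fin n) (Fin n) F) : Prop :=
  A.IsSymm ∧ ∀ r : Fin n, IsPos (leadingMinor A r)

/-- The entrywise application `f[A]` of `f` to the matrix `A`. -/
def entrywiseMap {F : Type*} {n : ℕ} (f : F → F) (A : Matrix (Fin n) (Fin n) F) :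
    Matrix (Fin n) (Fin n) F := Matrix.of fun i j => f (A i j)

/-- `f` preserves positivity on `n × n` matrices. -/
def PreservesPos {F : Type*} [Field F] (n : ℕ) (f : F → F) : Prop :=
  ∀ A : Matrix (Fin n) (Fin n) F, IsPosDef A → IsPosDef (entrywiseMap f A)

section Positive

variable {F : Type*} [Field F]

theorem IsPos.ne_zero {x : F} (h : IsPos x) : x ≠ 0 := by
  obtain ⟨y, hy, rfl⟩ := h
  exact pow_ne_zero 2 hy

theorem isPos_sq {x : F} (h : x ≠ 0) : IsPos (x ^ 2) := ⟨x, h, rfl⟩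

theorem isPos_one : IsPos (1 : F) := ⟨1, one_ne_zero, one_pow 2⟩

theorem not_isPos_zero : ¬ IsPos (0 : F) := fun h => h.ne_zero rfl

theorem IsPos.mul {x y : F} (hx : IsPos x) (hy : IsPos y) : IsPos (x * y) := by
  obtain ⟨a, ha, rfl⟩ := hx
  obtain ⟨b, hb, rfl⟩ := hy
  exact ⟨a * b, mul_ne_zero ha hb, mul_pow a b 2⟩

theorem IsPos.inv {x : F} (hx : IsPos x) : IsPos x⁻¹ := by
  obtain ⟨a, ha, rfl⟩ := hx
  exact ⟨a⁻¹, inv_ne_zero ha, inv_pow a 2⟩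

theorem IsPos.div {x y : F} (hx : IsPos x) (hy : IsPos y) : IsPos (x / y) := by
  rw [div_eq_mul_inv]
  exact hx.mul hy.inv

theorem IsPos.pow {x : F} (hx : IsPos x) (m : ℕ) : IsPos (x ^ m) := by
  obtain ⟨a, ha, rfl⟩ := hx
  exact ⟨a ^ m, pow_ne_zero m ha, by rw [← pow_mul, ← pow_mul, mul_comm]⟩

theorem IsPos.of_mul_left {x y : F} (hx : IsPos x) (h : IsPos (x * y)) : IsPos y := by
  have := hx.inv.mul h
  rwa [inv_mul_cancel_left₀ hx.ne_zero] at this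

theorem not_isPos_neg (hneg : ¬ IsPos (-1 : F)) {x : F} (hx : IsPos x) : ¬ IsPos (-x) := by
  intro h
  exact hneg (hx.of_mul_left (by simpa using h))

variable [Fintype F]

/-- The product of two nonzero nonsquares of a finite field is a square. -/
theorem isPos_mul_of_not_isPos {x y : F} (hx0 : x ≠ 0) (hy0 : y ≠ 0)
    (hx : ¬ IsPos x) (hy : ¬ IsPos y) : IsPos (x * y) := by
  classical
  have key : ∀ z : F, z ≠ 0 → ¬ IsPos z → quadraticChar F z = -1 := by
    intro z hz h
    rw [quadraticChar_neg_one_iff_not_isSquare]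
    rintro ⟨w, rfl⟩
    exact h ⟨w, left_ne_zero_of_mul hz, sq w⟩
  have h1 : quadraticChar F (x * y) = 1 := by
    rw [map_mul, key x hx0 hx, key y hy0 hy]
    norm_num
  obtain ⟨w, hw⟩ := (quadraticChar_one_iff_isSquare (mul_ne_zero hx0 hy0)).1 h1
  rw [hw, ← sq]
  refine isPos_sq ?_
  rintro rfl
  exact mul_ne_zero hx0 hy0 (by simpa using hw)

theorem isPos_neg_of_not_isPos (hneg : ¬ IsPos (-1 : F)) {x : F} (hx0 : x ≠ 0)
    (hx : ¬ IsPos x) : IsPos (-x) := by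
  rw [← neg_one_mul]
  exact isPos_mul_of_not_isPos (neg_ne_zero.2 one_ne_zero) hx0 hneg hx

/-- The set of positive elements is not stable under any nontrivial translation. -/
theorem eq_zero_of_isPos_sub {h : F} (H : ∀ x : F, IsPos x → IsPos (x - h)) : h = 0 := by
  by_contra h0
  have hnot : ¬ IsPos h := fun hh => not_isPos_zero (by simpa using H h hh)
  by_cases hneg : IsPos (-1 : F)
  · have h1 := H 1 isPos_one
    have h2 := H (h ^ 2) (isPos_sq h0)
    refine hnot ((hneg.mul h1).of_mul_left ?_)
    convert h2 using 1
    ring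
  · have hh := isPos_neg_of_not_isPos hneg h0 hnot
    have key : ∀ m : ℕ, IsPos (((m : F) + 1) * -h) := by
      intro m
      induction m with
      | zero => simpa using hh
      | succ m ih =>
        convert H _ ih using 1
        push_cast
        ring
    have hq := key (Fintype.card F - 1)
    rw [Nat.cast_sub Fintype.card_pos] at hq
    simp [not_isPos_zero] at hq

/-- Every element of a finite field of odd order is a sum of two squares, and for a nonzero element
one of them can be taken nonzero. -/
theorem exists_eq_sq_add_sq (h2 : (2 : F) ≠ 0) {m : F} (hm : m ≠ 0) :
    ∃ t w : F, w ≠ 0 ∧ m = t ^ 2 + w ^ 2 := by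
  obtain ⟨a, b, hab⟩ := FiniteField.exists_root_sum_quadratic
    (f := (Polynomial.X ^ 2 : Polynomial F)) (g := Polynomial.X ^ 2 - Polynomial.C m)
    (Polynomial.degree_X_pow 2) (Polynomial.degree_X_pow_sub_C (by decide) _)
    (FiniteField.odd_card_of_char_ne_two fun h => h2 (by
      have := ringChar.Nat.cast_ringChar (R := F)
      rw [h] at this
      exact_mod_cast this))
  have hm' : m = a ^ 2 + b ^ 2 := by
    simp only [Polynomial.eval_pow, Polynomial.eval_X, Polynomial.eval_sub,
      Polynomial.eval_C] at hab
    linear_combination -hab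
  by_cases hb : b = 0
  · refine ⟨b, a, ?_, by rw [hm', add_comm]⟩
    rintro rfl
    exact hm (by rw [hm', hb]; ring)
  · exact ⟨a, b, hb, hm'⟩

/-- Injections in both directions between subsets of a finite type are surjective. -/
theorem exists_of_injOn {α : Type*} [Finite α] {f σ : α → α} {S T : Set α}
    (hf : Set.MapsTo f S T) (hfi : Set.InjOn f S) (hσ : Set.MapsTo σ T S)
    (hσi : Set.InjOn σ T) {w : α} (hw : w ∈ T) : ∃ c ∈ S, f c = w := by
  have hle : T.ncard ≤ (f '' S).ncard := by
    rw [hfi.ncard_image]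
    exact Set.ncard_le_ncard_of_injOn σ hσ hσi
  have := Set.eq_of_subset_of_ncard_le hf.image_subset hle
  rwa [← this] at hw

end Positive

section Reduction

variable {F : Type*} [Field F]

/-- `f` preserves positivity on symmetric `3 × 3` matrices, in terms of the matrix entries. -/
def PreservesPosThree (f : F → F) : Prop :=
  ∀ a b c d e g : F, IsPos a → IsPos (a * d - b ^ 2) →
    IsPos (a * d * g + 2 * b * c * e - a * e ^ 2 - b ^ 2 * g - c ^ 2 * d) →
    IsPos (f a) ∧ IsPos (f a * f d - f b ^ 2) ∧
      IsPos (f a * f d * f g + 2 * f b * f c * f e - f a * f e ^ 2 - f b ^ 2 * f g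
        - f c ^ 2 * f d)

theorem isPosDef_three_iff (a b c d e g : F) :
    IsPosDef !![a, b, c; b, d, e; c, e, g] ↔ IsPos a ∧ IsPos (a * d - b ^ 2) ∧
      IsPos (a * d * g + 2 * b * c * e - a * e ^ 2 - b ^ 2 * g - c ^ 2 * d) := by
  have hs : (!![a, b, c; b, d, e; c, e, g]).IsSymm := by
    ext i j
    fin_cases i <;> fin_cases j <;> rfl
  have h0 : leadingMinor !![a, b, c; b, d, e; c, e, g] 0 = a := by
    simp [leadingMinor]
  have h1 : leadingMinor !![a, b, c; b, d, e; c, e, g] 1 = a * d - b ^ 2 := by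
    change Matrix.det (n := Fin 2) _ = _
    rw [Matrix.det_fin_two]
    change a * d - b * b = _
    ring
  have h2 : leadingMinor !![a, b, c; b, d, e; c, e, g] 2 =
      a * d * g + 2 * b * c * e - a * e ^ 2 - b ^ 2 * g - c ^ 2 * d := by
    change Matrix.det (n := Fin 3) _ = _
    rw [Matrix.det_fin_three]
    change a * d * g - a * e * e - b * b * g + b * e * c + c * b * e - c * d * c = _
    ring
  simp only [IsPosDef, hs, true_and, Fin.forall_fin_succ, Fin.forall_fin_zero]
  simp [h0, h1, h2]

theorem PreservesPos.three {f : F → F} (h : PreservesPos 3 f) : PreservesPosThree f := by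
  intro a b c d e g h1 h2 h3
  rw [← isPosDef_three_iff]
  convert h _ ((isPosDef_three_iff a b c d e g).2 ⟨h1, h2, h3⟩) using 1
  ext i j
  fin_cases i <;> fin_cases j <;> rfl

theorem PreservesPos.of_succ {n : ℕ} {f : F → F} (h : PreservesPos (n + 1) f) :
    PreservesPos n f := by
  intro A hA
  let M : Matrix (Fin (n + 1)) (Fin (n + 1)) F :=
    (Matrix.fromBlocks A 0 0 (1 : Matrix (Fin 1) (Fin 1) F)).submatrix
      finSumFinEquiv.symm finSumFinEquiv.symm
  have hMA : ∀ i j : Fin n, M i.castSucc j.castSucc = A i j := by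
    intro i j
    simp [M]
  have hminor : ∀ (B : Matrix (Fin n) (Fin n) F) (N : Matrix (Fin (n + 1)) (Fin (n + 1)) F),
      (∀ i j : Fin n, N i.castSucc j.castSucc = B i j) →
      ∀ r : Fin n, leadingMinor N r.castSucc = leadingMinor B r := by
    intro B N hNB r
    unfold leadingMinor
    congr 1
    ext i j
    exact hNB (Fin.castLE r.isLt i) (Fin.castLE r.isLt j)
  have hM : IsPosDef M := by
    refine ⟨?_, fun r => ?_⟩
    · refine Matrix.IsSymm.submatrix ?_ _
      exact Matrix.IsSymm.fromBlocks hA.1 (by simp) Matrix.isSymm_one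
    · induction r using Fin.lastCases with
      | cast r =>
        rw [hminor A M hMA]
        exact hA.2 r
      | last =>
        have hdet : leadingMinor M (Fin.last n) = A.det := by
          change (M.submatrix id id).det = _
          rw [Matrix.submatrix_id_id, Matrix.det_submatrix_equiv_self,
            Matrix.det_fromBlocks_zero₂₁, Matrix.det_one, mul_one]
        rw [hdet]
        cases n with
        | zero =>
          rw [Matrix.det_isEmpty]
          exact isPos_one
        | succ n => exact hA.2 (Fin.last n)
  have hfM := h M hM
  refine ⟨?_, fun r => ?_⟩
  · ext i j
    exact congrArg f (hA.1.apply i j)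
  · rw [← hminor (entrywiseMap f A) (entrywiseMap f M) (fun i j => congrArg f (hMA i j)) r]
    exact hfM.2 _

theorem PreservesPos.of_le {m n : ℕ} (hmn : m ≤ n) {f : F → F} (h : PreservesPos n f) :
    PreservesPos m f := by
  induction n, hmn using Nat.le_induction with
  | base => exact h
  | succ n _ ih => exact ih h.of_succ

/-- A positive multiple of a ring endomorphism preserves positivity. -/
theorem preservesPos_mul_ringHom (n : ℕ) {c : F} (hc : IsPos c) (φ : F →+* F) :
    PreservesPos n fun x => c * φ x := by
  intro A hA
  refine ⟨?_, fun r => ?_⟩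
  · ext i j
    exact congrArg (fun x => c * φ x) (hA.1.apply i j)
  · have : leadingMinor (entrywiseMap (fun x => c * φ x) A) r =
        c ^ (r.1 + 1) * φ (leadingMinor A r) := by
      unfold leadingMinor
      rw [RingHom.map_det, ← Fintype.card_fin (r.1 + 1), ← Matrix.det_smul]
      rfl
    rw [this]
    obtain ⟨y, hy, hy'⟩ := hA.2 r
    exact (hc.pow _).mul ⟨φ y, (map_ne_zero φ).2 hy, by rw [← hy', map_pow]⟩

theorem PreservesPosThree.div {f : F → F} (h : PreservesPosThree f) :
    PreservesPosThree fun x => f x / f 1 := by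
  have h1 : IsPos (f 1) := by
    refine (h 1 0 0 1 0 1 isPos_one ?_ ?_).1 <;> simp [isPos_one]
  have h0 := h1.ne_zero
  intro a b c d e g ha hb hc
  obtain ⟨h1', h2', h3'⟩ := h a b c d e g ha hb hc
  refine ⟨h1'.div h1, ?_, ?_⟩
  · convert h2'.div (h1.pow 2) using 1
    field_simp
  · convert h3'.div (h1.pow 3) using 1
    field_simp

/-- The ring endomorphisms of a finite field are the powers of the Frobenius map. -/
theorem exists_frobenius_pow_of_ringHom [Fintype F] {p k : ℕ} (hp : p.Prime)
    (hcard : Fintype.card F = p ^ k) (φ : F →+* F) :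
    ∃ ℓ : ℕ, ℓ ≤ k - 1 ∧ ∀ x : F, φ x = x ^ p ^ ℓ := by
  have : Fact p.Prime := ⟨hp⟩
  have : CharP F p := charP_of_card_eq_prime_pow hcard
  let := ZMod.algebra F p
  have hfr : Module.finrank (ZMod p) F = k := by
    have := Module.card_eq_pow_finrank (K := ZMod p) (V := F)
    rw [ZMod.card, hcard] at this
    exact (Nat.pow_right_injective hp.two_le this).symm
  let ψ : F →ₐ[ZMod p] F := { φ with
    commutes' := fun r => RingHom.congr_fun (Subsingleton.elim (φ.comp (algebraMap _ _)) _) r }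
  obtain ⟨i, hi⟩ := (FiniteField.bijective_frobeniusAlgHom_pow (ZMod p) F).2 ψ
  refine ⟨i.1, by have := i.2; omega, fun x => ?_⟩
  have := DFunLike.congr_fun hi x
  simp only [AlgHom.coe_pow, FiniteField.coe_frobeniusAlgHom, pow_iterate, ZMod.card] at this
  exact this.symm

end Reduction

section Preservers

variable {F : Type*} [Field F] {f : F → F}

theorem PreservesPosThree.isPos (h : PreservesPosThree f) {a : F} (ha : IsPos a) :
    IsPos (f a) := by
  refine (h a 0 0 a 0 1 ha ?_ ?_).1
  · simpa using ha.mul ha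
  · simpa using ha.mul ha

theorem PreservesPosThree.isPos_two (h : PreservesPosThree f) {a b d : F} (ha : IsPos a)
    (hd : IsPos (a * d - b ^ 2)) : IsPos (f a * f d - f b ^ 2) := by
  refine (h a b 0 d 0 1 ha hd ?_).2.1
  convert hd using 1
  ring

theorem PreservesPosThree.isPos_sub_sq (h : PreservesPosThree f) (h1 : f 1 = 1) {b d : F}
    (hd : IsPos (d - b ^ 2)) : IsPos (f d - f b ^ 2) := by
  have := h.isPos_two (a := 1) (b := b) (d := d) isPos_one (by simpa using hd)
  simpa [h1] using this

theorem PreservesPosThree.isPos_diag (h : PreservesPosThree f) (h0 : f 0 = 0) {s t a b c : F}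
    (hs : IsPos s) (ht : IsPos t) (hc : IsPos (s * t * c - s * b ^ 2 - t * a ^ 2)) :
    IsPos (f s * f t * f c - f s * f b ^ 2 - f t * f a ^ 2) := by
  have := (h s 0 a t b c hs (by simpa using hs.mul ht) (by convert hc using 1; ring)).2.2
  convert this using 1
  rw [h0]
  ring

/-- A multiplicative and additive unital map, bundled as a ring homomorphism. -/
theorem exists_ringHom_of_map_add_map_mul (h0 : f 0 = 0) (h1 : f 1 = 1)
    (hadd : ∀ x y, f (x + y) = f x + f y) (hmul : ∀ x y, f (x * y) = f x * f y) :
    ∃ φ : F →+* F, ∀ x, f x = φ x :=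
  ⟨{ toFun := f, map_one' := h1, map_mul' := hmul, map_zero' := h0, map_add' := hadd },
    fun _ => rfl⟩

variable [Fintype F]

theorem isPos_of_two_eq_zero (h2 : (2 : F) = 0) {x : F} (hx : x ≠ 0) : IsPos x := by
  have : ringChar F = 2 :=
    ringChar.eq_iff.2 (CharTwo.of_one_ne_zero_of_two_eq_zero one_ne_zero h2)
  obtain ⟨y, rfl⟩ := FiniteField.isSquare_of_char_two this x
  rw [← sq]
  exact isPos_sq (left_ne_zero_of_mul hx)

theorem PreservesPosThree.exists_ringHom_of_two_eq_zero (h2 : (2 : F) = 0)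
    (h : PreservesPosThree f) (h1 : f 1 = 1) : ∃ φ : F →+* F, ∀ x, f x = φ x := by
  have hpos : ∀ {x : F}, x ≠ 0 → IsPos x := isPos_of_two_eq_zero h2
  have hsq : ∀ x : F, ∃ y : F, y ^ 2 = x := by
    intro x
    by_cases hx : x = 0
    · exact ⟨0, by rw [hx]; ring⟩
    · obtain ⟨y, -, hy⟩ := hpos hx
      exact ⟨y, hy⟩
  have hne : ∀ a b : F, a ≠ 0 → a ≠ b → f a ≠ f b := by
    intro a b ha hab heq
    have hd : a * a - b ^ 2 ≠ 0 := by
      have : a * a - b ^ 2 = (a - b) ^ 2 := by linear_combination (b * (a - b)) * h2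
      rw [this]
      exact pow_ne_zero 2 (sub_ne_zero.2 hab)
    refine (h.isPos_two (hpos ha) (hpos hd)).ne_zero ?_
    rw [heq]
    ring
  have hinj : Function.Injective f := by
    intro a b hab
    by_contra hne'
    by_cases ha : a = 0
    · exact hne b a (fun hb => hne' (ha.trans hb.symm)) (Ne.symm hne') hab.symm
    · exact hne a b ha hne' hab
  have hsurj := Finite.surjective_of_injective hinj
  have h0 : f 0 = 0 := by
    obtain ⟨z, hz⟩ := hsurj 0
    by_cases hz0 : z = 0
    · rwa [hz0] at hz
    · exact absurd hz (h.isPos (hpos hz0)).ne_zero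
  have hfsq : ∀ b, f (b ^ 2) = f b ^ 2 := by
    intro b
    obtain ⟨c, hc⟩ := hsurj (f b ^ 2)
    by_cases hcb : c - b ^ 2 = 0
    · rw [← sub_eq_zero.1 hcb, hc]
    · exact absurd (sub_eq_zero.2 hc) (h.isPos_sub_sq h1 (hpos hcb)).ne_zero
  refine exists_ringHom_of_map_add_map_mul h0 h1 (fun x y => ?_) (fun x y => ?_)
  · obtain ⟨a, rfl⟩ := hsq x
    obtain ⟨b, rfl⟩ := hsq y
    obtain ⟨c, hc⟩ := hsurj (f (a ^ 2) + f (b ^ 2))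
    by_cases hcb : c - b ^ 2 - a ^ 2 = 0
    · rw [← hc]
      congr 1
      linear_combination -hcb
    · have := h.isPos_diag h0 (a := a) (b := b) (c := c) isPos_one isPos_one
        (hpos (by simpa using hcb))
      refine absurd ?_ this.ne_zero
      rw [h1, hc, hfsq, hfsq]
      ring
  · by_cases hx : x = 0
    · rw [hx, h0, zero_mul, zero_mul, h0]
    obtain ⟨b, hb⟩ := hsq (x * y)
    obtain ⟨c, hc⟩ := hsurj (f (x * y) / f x)
    have hfx := (h.isPos (hpos hx)).ne_zero
    have hc' : f x * f c = f b ^ 2 := by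
      rw [hc, ← hfsq, hb]
      field_simp
    by_cases hcb : x * c - b ^ 2 = 0
    · have : c = y := mul_left_cancel₀ hx (by linear_combination hcb + hb)
      rw [← this, hc', ← hfsq, hb, this]
    · exact absurd (sub_eq_zero.2 hc') (h.isPos_two (hpos hx) (hpos hcb)).ne_zero

/-- An injective map sends each translate of the set of positive elements into at most one
translate of it. -/
theorem eq_of_isPos_sub_imp (hinj : Function.Injective f) {u g g' : F}
    (hg : ∀ c, IsPos (c - u) → IsPos (f c - g)) (hg' : ∀ c, IsPos (c - u) → IsPos (f c - g')) :
    g = g' := by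
  have key : ∀ x : F, IsPos x → IsPos (x - (g' - g)) := by
    intro x hx
    obtain ⟨c, hc, hcx⟩ := exists_of_injOn (f := f) (σ := fun w => w - g + u)
      (S := {c | IsPos (c - u)}) (T := {w | IsPos (w - g)}) (fun c hc => hg c hc)
      hinj.injOn (fun w hw => by simpa using hw) (fun w _ w' _ hww => by simpa using hww)
      (w := x + g) (by simpa using hx)
    have := hg' c hc
    rw [hcx] at this
    convert this using 1
    ring
  linear_combination -eq_zero_of_isPos_sub key

theorem PreservesPosThree.exists_ringHom_of_injective (h2 : (2 : F) ≠ 0)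
    (h : PreservesPosThree f) (h0 : f 0 = 0) (h1 : f 1 = 1) (hinj : Function.Injective f) :
    ∃ φ : F →+* F, ∀ x, f x = φ x := by
  have hone : ∀ c, IsPos (c - 1) → IsPos (f c - 1) := by
    intro c hc
    simpa [h1] using h.isPos_sub_sq h1 (b := 1) (d := c) (by simpa using hc)
  have hfsq : ∀ x, f (x ^ 2) = f x ^ 2 := by
    intro x
    by_cases hx : x = 0
    · rw [hx, h0]
      simpa using h0
    have hx2 := isPos_sq hx
    have hfx2 := h.isPos hx2
    have := eq_of_isPos_sub_imp (g' := f x ^ 2 / f (x ^ 2)) hinj hone ?_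
    · rw [eq_div_iff hfx2.ne_zero, one_mul] at this
      exact this
    · intro c hc
      refine hfx2.of_mul_left ?_
      convert h.isPos_two (b := x) (d := c) hx2 ?_ using 1
      · field_simp [hfx2.ne_zero]
      · convert hx2.mul hc using 1
        ring
  have hadd1 : ∀ x, f (1 + x ^ 2) = 1 + f x ^ 2 := by
    intro x
    have hR : IsPos (f (1 + x ^ 2) - f x ^ 2) := by
      refine h.isPos_sub_sq h1 ?_
      simpa using isPos_one
    have := eq_of_isPos_sub_imp (g' := 1 / (f (1 + x ^ 2) - f x ^ 2)) hinj hone ?_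
    · rw [eq_div_iff hR.ne_zero] at this
      linear_combination this
    · intro c hc
      refine hR.of_mul_left ?_
      convert (h 1 x 0 (1 + x ^ 2) 1 c isPos_one ?_ ?_).2.2 using 1
      · rw [h0, h1]
        field_simp [hR.ne_zero]
        ring
      · convert isPos_one using 1
        ring
      · convert hc using 1
        ring
  have hsub : ∀ x b, f (x - b) ^ 2 = (f x - f b) ^ 2 := by
    intro x b
    have := eq_of_isPos_sub_imp (u := 1 + (x - b) ^ 2) (g := 1 + f (x - b) ^ 2)
      (g' := 1 + (f x - f b) ^ 2) hinj ?_ ?_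
    · linear_combination this
    · intro c hc
      rw [← hadd1]
      convert h.isPos_diag h0 (s := 1) (t := 1) (a := 1) (b := x - b) (c := c) isPos_one isPos_one
        ?_ using 1
      · rw [hadd1, h1]
        ring
      · convert hc using 1
        ring
    · intro c hc
      convert (h 1 x 1 (1 + x ^ 2) b c isPos_one ?_ ?_).2.2 using 1
      · rw [hadd1, h1]
        ring
      · convert isPos_one using 1
        ring
      · convert hc using 1
        ring
  have hneg : ∀ x, f (-x) = -f x := by
    intro x
    have := hsub 0 x
    rw [h0, zero_sub, zero_sub] at this
    rcases sq_eq_sq_iff_eq_or_eq_neg.1 this with h' | h'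
    · exact h'
    · rw [neg_neg] at h'
      have hx : x = 0 := by
        refine (mul_eq_zero.1 (?_ : 2 * x = 0)).resolve_left h2
        linear_combination -hinj h'
      rw [hx, neg_zero, h0, neg_zero]
  have hadd : ∀ x y, f (x + y) = f x + f y := by
    intro x y
    have e1 := hsub x (-y)
    rw [sub_neg_eq_add, hneg, sub_neg_eq_add] at e1
    rcases sq_eq_sq_iff_eq_or_eq_neg.1 e1 with h' | h'
    · exact h'
    have e2 := hsub (x + y) y
    rw [add_sub_cancel_right] at e2
    rcases sq_eq_sq_iff_eq_or_eq_neg.1 e2 with h'' | h''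
    · have : f x = f (-y) := by
        rw [hneg]
        refine mul_left_cancel₀ h2 ?_
        linear_combination h'' + h'
      rw [this, hneg, hinj this, neg_add_cancel, neg_add_cancel, h0]
    · have : f y = f 0 := by
        rw [h0]
        refine mul_left_cancel₀ h2 ?_
        linear_combination -h'' + h'
      rw [hinj this, h0, add_zero, add_zero]
  refine exists_ringHom_of_map_add_map_mul h0 h1 hadd fun x y => ?_
  have e := hfsq (x + y)
  rw [show (x + y) ^ 2 = x ^ 2 + y ^ 2 + (x * y + x * y) by ring, hadd, hadd, hadd, hadd, hfsq,
    hfsq] at e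
  refine mul_left_cancel₀ h2 ?_
  linear_combination e

/-- A preserver separates a positive element `a` from every other element, except possibly `-a`
when `-1` is not a square. -/
theorem PreservesPosThree.ne_of_isPos (h2 : (2 : F) ≠ 0) (h : PreservesPosThree f) {a b : F}
    (ha : IsPos a) (hab : a ≠ b) (hab' : IsPos (-1 : F) ∨ a ≠ -b) : f a ≠ f b := by
  intro heq
  obtain ⟨t, w, hw, htw⟩ : ∃ t w : F, w ≠ 0 ∧ a ^ 2 - b ^ 2 = t ^ 2 + w ^ 2 := by
    by_cases hm : a ^ 2 - b ^ 2 = 0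
    · have hb : a = -b :=
        (sq_eq_sq_iff_eq_or_eq_neg.1 (sub_eq_zero.1 hm)).resolve_left hab
      obtain ⟨i, hi, hi'⟩ := hab'.resolve_right (not_not.2 hb)
      exact ⟨1, i, hi, by rw [hm, hi']; ring⟩
    · exact exists_eq_sq_add_sq h2 hm
  have hd := sub_ne_zero.2 hab
  have ha0 := ha.ne_zero
  have hx := (h a (t / (a - b)) b (((t / (a - b)) ^ 2 + 1) / a) (t / (a - b)) a ha ?_ ?_).2.2
  · refine hx.ne_zero ?_
    rw [heq]
    ring
  · convert isPos_one using 1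
    field_simp
    ring
  · convert (isPos_sq hw).div ha using 1
    rw [← sub_eq_iff_eq_add'.2 htw]
    field_simp
    ring

theorem PreservesPosThree.exists_isPos_eq
    (h : PreservesPosThree f) (hinj : ∀ a b, IsPos a → IsPos b → f a = f b → a = b) {w : F}
    (hw : IsPos w) : ∃ c, IsPos c ∧ f c = w :=
  exists_of_injOn (f := f) (σ := id) (S := {c | IsPos c}) (T := {c | IsPos c})
    (fun _ hc => h.isPos hc) (fun a ha b hb hab => hinj a b ha hb hab) (fun _ hc => hc)
    Function.injective_id.injOn hw

theorem PreservesPosThree.map_zero_of_injOn (h : PreservesPosThree f) (h1 : f 1 = 1)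
    (hinj : ∀ a b, IsPos a → IsPos b → f a = f b → a = b) : f 0 = 0 := by
  by_contra h0
  obtain ⟨c, hc, hc'⟩ := h.exists_isPos_eq hinj (isPos_sq h0)
  exact (h.isPos_sub_sq h1 (b := 0) (d := c) (by simpa using hc)).ne_zero (sub_eq_zero.2 hc')

/-- An implication between conditions on `c` and on `f c` is an equivalence if scaling by a positive
element carries the second condition back to the first. -/
theorem PreservesPosThree.iff_of_imp (h : PreservesPosThree f)
    (hinj : ∀ a b, IsPos a → IsPos b → f a = f b → a = b) {Q Q' : F → Prop} {u : F}
    (hu : IsPos u) (hQ : ∀ c, IsPos c → Q c → Q' (f c))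
    (hQ' : ∀ w, IsPos w → Q' w → Q (u * w)) {c : F} (hc : IsPos c) : Q c ↔ Q' (f c) := by
  refine ⟨hQ c hc, fun hfc => ?_⟩
  obtain ⟨c', hc', he⟩ := exists_of_injOn (f := f) (σ := fun w => u * w)
    (S := {c | IsPos c ∧ Q c}) (T := {w | IsPos w ∧ Q' w})
    (fun c hc => ⟨h.isPos hc.1, hQ c hc.1 hc.2⟩)
    (fun a ha b hb hab => hinj a b ha.1 hb.1 hab)
    (fun w hw => ⟨hu.mul hw.1, hQ' w hw.1 hw.2⟩)
    (mul_right_injective₀ hu.ne_zero).injOn (w := f c) ⟨h.isPos hc, hfc⟩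
  rw [← hinj c' c hc'.1 hc he]
  exact hc'.2

theorem PreservesPosThree.injective_of_isPos_neg_one (h2 : (2 : F) ≠ 0)
    (h : PreservesPosThree f) (h1 : f 1 = 1) (hneg : IsPos (-1 : F)) :
    Function.Injective f := by
  have hne : ∀ a b, IsPos a → f a = f b → a = b := fun a b ha hab =>
    by_contra fun hn => h.ne_of_isPos h2 ha hn (Or.inl hneg) hab
  have hinj : ∀ a b, IsPos a → IsPos b → f a = f b → a = b := fun a b ha _ => hne a b ha
  have h0 := h.map_zero_of_injOn h1 hinj
  have hnegpos : ∀ x : F, IsPos x → IsPos (-x) := fun x hx => by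
    rw [← neg_one_mul]
    exact hneg.mul hx
  have hzero : ∀ {a b s t : F}, IsPos s → IsPos t → s * b ^ 2 + t * a ^ 2 = 0 →
      f s * f b ^ 2 + f t * f a ^ 2 = 0 := by
    intro a b s t hs ht hst
    have hfs := h.isPos hs
    have hft := h.isPos ht
    have hst' := hfs.mul hft
    have := eq_zero_of_isPos_sub (h := (f s * f b ^ 2 + f t * f a ^ 2) / (f s * f t)) ?_
    · exact (div_eq_zero_iff.1 this).resolve_right hst'.ne_zero
    · intro x hx
      obtain ⟨c, hc, rfl⟩ := h.exists_isPos_eq hinj hx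
      refine hst'.of_mul_left ?_
      convert h.isPos_diag h0 (a := a) (b := b) (c := c) hs ht ?_ using 1
      · rw [mul_sub, mul_div_cancel₀ _ hst'.ne_zero]
        ring
      · convert (hs.mul ht).mul hc using 1
        linear_combination -hst
  obtain ⟨i, hi, hi'⟩ := hneg
  have hfi : f i ^ 2 = -1 := by
    have := hzero (a := 1) (b := i) isPos_one isPos_one (by rw [hi']; ring)
    rw [h1] at this
    linear_combination this
  have hfsq : ∀ x, x ≠ 0 → f (x ^ 2) = f x ^ 2 := by
    intro x hx
    have := hzero (a := x) (b := i) (isPos_sq hx) isPos_one (by rw [hi']; ring)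
    rw [h1, hfi] at this
    linear_combination -this
  have hinjN : ∀ a b, ¬ IsPos a → a ≠ 0 → f a = f b → a ≠ -b := by
    rintro a b ha ha0 hfab rfl
    have he : ¬ IsPos (f b) := by
      intro hpos
      obtain ⟨s, hs, hs'⟩ := h.exists_isPos_eq hinj hpos
      exact ha (hne s (-b) hs (hs'.trans hfab.symm) ▸ hs)
    have hb0 : b ≠ 0 := neg_ne_zero.1 ha0
    have hb : ¬ IsPos b := fun hb => ha (hnegpos b hb)
    have he0 : f b ≠ 0 := by
      intro he0
      have := hfsq b hb0
      rw [he0] at this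
      exact (h.isPos (isPos_sq hb0)).ne_zero (by rw [this]; ring)
    have himp : ∀ y, IsPos y → IsPos (b - y) → IsPos (f b - f y) := by
      rintro y ⟨x, hx, rfl⟩ hy
      rw [hfsq x hx]
      exact h.isPos_sub_sq h1 hy
    have himp' : ∀ y, IsPos y → IsPos (b + y) → IsPos (f b - f y) := by
      rintro y ⟨x, hx, rfl⟩ hy
      rw [hfsq x hx, ← hfab]
      refine h.isPos_sub_sq h1 ?_
      convert hnegpos _ hy using 1
      ring
    have hbe : IsPos (b / f b) := by
      convert (isPos_mul_of_not_isPos hb0 he0 hb he).div (isPos_sq he0) using 1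
      field_simp
    have hiff : ∀ y, IsPos y → (IsPos (b - y) ↔ IsPos (f b - f y)) := fun y hy =>
      h.iff_of_imp hinj (Q := fun y => IsPos (b - y)) (Q' := fun w => IsPos (f b - w)) hbe himp
        (fun w _ hw => by
          convert hbe.mul hw using 1
          field_simp) hy
    have hplus : ∀ y, IsPos y → IsPos (b + y) → IsPos (b - y) := fun y hy hby =>
      (hiff y hy).2 (himp' y hy hby)
    have hbp : ∀ y, IsPos y → b + y ≠ 0 := fun y hy hby =>
      ha (by rwa [neg_eq_of_add_eq_zero_right hby])
    have hbm : ∀ y, IsPos y → b - y ≠ 0 := fun y hy hby => hb (by rwa [sub_eq_zero.1 hby])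
    have hquot : ∀ y, IsPos y → IsPos ((b + y) / (b - y)) := by
      intro y hy
      by_cases hp : IsPos (b + y)
      · exact hp.div (hplus y hy hp)
      · have hm : ¬ IsPos (b - y) := fun hm => hp (by
          simpa using hplus (-y) (hnegpos y hy) (by simpa [sub_eq_add_neg] using hm))
        convert (isPos_mul_of_not_isPos (hbp y hy) (hbm y hy) hp hm).div
          (isPos_sq (hbm y hy)) using 1
        have := hbm y hy
        field_simp
    obtain ⟨y, hy, hy1⟩ := exists_of_injOn (f := fun y => (b + y) / (b - y)) (σ := id)
      (S := {c : F | IsPos c}) (T := {c | IsPos c}) hquot (fun y hy z hz hyz => by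
        have e : (b + y) / (b - y) = (b + z) / (b - z) := hyz
        rw [div_eq_div_iff (hbm y hy) (hbm z hz)] at e
        refine mul_left_cancel₀ (mul_ne_zero h2 hb0) ?_
        linear_combination e) (fun _ hc => hc) Function.injective_id.injOn (w := 1) isPos_one
    have e : (b + y) / (b - y) = 1 := hy1
    rw [div_eq_one_iff_eq (hbm y hy)] at e
    refine hy.ne_zero ((mul_eq_zero.1 (?_ : 2 * y = 0)).resolve_left h2)
    linear_combination e
  have hf0 : ∀ x, f x = 0 → x = 0 := by
    intro x hx
    by_contra hx0
    refine (h.isPos (isPos_sq hx0)).ne_zero ?_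
    rw [hfsq x hx0, hx]
    ring
  intro a b hab
  by_cases ha : IsPos a
  · exact hne a b ha hab
  by_cases ha0 : a = 0
  · rw [ha0, h0] at hab
    rw [ha0, hf0 b hab.symm]
  have hb0 : b ≠ 0 := by
    rintro rfl
    exact ha0 (hf0 a (hab.trans h0))
  have hsq : a ^ 2 = b ^ 2 := by
    refine hinj _ _ (isPos_sq ha0) (isPos_sq hb0) ?_
    rw [hfsq a ha0, hfsq b hb0, hab]
  exact (sq_eq_sq_iff_eq_or_eq_neg.1 hsq).resolve_right (hinjN a b ha ha0 hab)

theorem PreservesPosThree.injective_of_not_isPos_neg_one (h2 : (2 : F) ≠ 0)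
    (h : PreservesPosThree f) (h1 : f 1 = 1) (hneg : ¬ IsPos (-1 : F)) :
    Function.Injective f := by
  have hnp : ∀ {x : F}, IsPos x → ¬ IsPos (-x) := not_isPos_neg hneg
  have htri : ∀ x : F, x ≠ 0 → IsPos x ∨ IsPos (-x) := fun x hx => by
    by_cases hp : IsPos x
    · exact Or.inl hp
    · exact Or.inr (isPos_neg_of_not_isPos hneg hx hp)
  have hinj : ∀ a b, IsPos a → IsPos b → f a = f b → a = b := by
    intro a b ha hb hab
    by_contra hn
    refine h.ne_of_isPos h2 ha hn (Or.inr ?_) hab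
    rintro rfl
    exact hnp hb ha
  have h0 := h.map_zero_of_injOn h1 hinj
  have hsqrt : ∀ y : F, IsPos y → ∃ x, IsPos x ∧ x ^ 2 = y := by
    rintro y ⟨x, hx, rfl⟩
    rcases htri x hx with h' | h'
    · exact ⟨x, h', rfl⟩
    · exact ⟨-x, h', neg_sq x⟩
  have hin : ∀ c x, IsPos c → x ≠ 0 → f x ≠ 0 →
      (IsPos (c - x ^ 2) ↔ IsPos (f c - f x ^ 2)) := by
    intro c x hc hx hfx
    have hu := (isPos_sq hx).div (isPos_sq hfx)
    refine h.iff_of_imp hinj (Q := fun c => IsPos (c - x ^ 2))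
      (Q' := fun w => IsPos (w - f x ^ 2)) hu (fun c _ hcx => h.isPos_sub_sq h1 hcx)
      (fun w _ hw => ?_) hc
    convert hu.mul hw using 1
    field_simp
  have hmono : ∀ x y, IsPos x → IsPos y → IsPos (y ^ 2 - x ^ 2) →
      IsPos (f y ^ 2 - f x ^ 2) := by
    intro x y _ hy hxy
    convert h.isPos_two (b := x) (d := y) hy ?_ using 1
    · ring
    · convert hxy using 1
      ring
  have hmono_iff : ∀ x y, IsPos x → IsPos y →
      (IsPos (y ^ 2 - x ^ 2) ↔ IsPos (f y ^ 2 - f x ^ 2)) := by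
    intro x y hx hy
    refine ⟨hmono x y hx hy, fun hf => ?_⟩
    by_cases he : y ^ 2 - x ^ 2 = 0
    · rcases sq_eq_sq_iff_eq_or_eq_neg.1 (sub_eq_zero.1 he) with rfl | rfl
      · exact absurd (sub_self _) hf.ne_zero
      · exact absurd hy (hnp hx)
    · refine (htri _ he).resolve_right fun hp => ?_
      rw [neg_sub] at hp
      refine hnp (hmono y x hy hx hp) ?_
      rwa [neg_sub]
  have hfsq : ∀ y, IsPos y → f (y ^ 2) = f y ^ 2 := by
    intro y hy
    have hy2 := isPos_sq hy.ne_zero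
    have hfy2 := isPos_sq (h.isPos hy).ne_zero
    have hz : ∀ z, IsPos z → (IsPos (f (y ^ 2) - z) ↔ IsPos (f y ^ 2 - z)) := by
      intro z hz
      obtain ⟨z', hz', rfl⟩ := hsqrt z hz
      obtain ⟨x, hx, rfl⟩ := h.exists_isPos_eq hinj hz'
      rw [← hin _ x hy2 hx.ne_zero hz'.ne_zero, hmono_iff x y hx hy]
    by_contra hn
    rcases htri _ (sub_ne_zero.2 hn) with hp | hp
    · exact not_isPos_zero (by simpa using (hz _ hfy2).1 hp)
    · rw [neg_sub] at hp
      exact not_isPos_zero (by simpa using (hz _ (h.isPos hy2)).2 hp)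
  have hnegsub : ∀ a t, IsPos t → IsPos (-(a + t)) → IsPos (f (-a) - f t) := by
    intro a t ht hat
    obtain ⟨x, hx, rfl⟩ := hsqrt t ht
    rw [hfsq x hx]
    refine h.isPos_sub_sq h1 ?_
    convert hat using 1
    ring
  have hex : ∀ a : F, IsPos a → ∃ t, IsPos t ∧ IsPos (-(a + t)) := by
    intro a ha
    by_contra! hall
    refine ha.ne_zero (neg_eq_zero.1 (eq_zero_of_isPos_sub fun x hx => ?_))
    rw [sub_neg_eq_add, add_comm]
    refine (htri _ fun hax => ?_).resolve_right (hall x hx)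
    exact hnp hx (by rwa [neg_eq_of_add_eq_zero_left hax])
  have hodd : ∀ a : F, IsPos a → f (-a) = -f a := by
    intro a ha
    obtain ⟨t, ht, hat⟩ := hex a ha
    have hfa := h.isPos ha
    have hlt := hnegsub a t ht hat
    have hne0 : f (-a) ≠ 0 := by
      intro he
      rw [he, zero_sub] at hlt
      exact hnp (h.isPos ht) hlt
    have hsq : f (-a) ^ 2 = f a ^ 2 := by
      have hz : ∀ z, IsPos z → (IsPos (z - f (-a) ^ 2) ↔ IsPos (z - f a ^ 2)) := by
        intro z hz
        obtain ⟨c, hc, rfl⟩ := h.exists_isPos_eq hinj hz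
        rw [← hin c (-a) hc (neg_ne_zero.2 ha.ne_zero) hne0, neg_sq,
          hin c a hc ha.ne_zero hfa.ne_zero]
      by_contra hn
      rcases htri _ (sub_ne_zero.2 hn) with hp | hp
      · exact not_isPos_zero (by simpa using (hz _ (isPos_sq hne0)).2 hp)
      · rw [neg_sub] at hp
        exact not_isPos_zero (by simpa using (hz _ (isPos_sq hfa.ne_zero)).1 hp)
    refine (sq_eq_sq_iff_eq_or_eq_neg.1 hsq).resolve_left fun he => ?_
    have key : ∀ t, IsPos t → IsPos (-(a + t)) → IsPos (a - t) := by
      intro t ht hat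
      have := hnegsub a t ht hat
      rw [he] at this
      obtain ⟨x, hx, rfl⟩ := hsqrt t ht
      rw [hfsq x hx] at this
      exact (hin a x ha hx.ne_zero (h.isPos hx).ne_zero).2 this
    have k1 := key t ht hat
    have ht0 := ht.ne_zero
    have hat' := ha.div ht
    have k2 := key (a * (a / t)) (ha.mul hat') (by
      convert hat'.mul hat using 1
      field_simp
      ring)
    refine hnp k1 (hat'.of_mul_left ?_)
    convert k2 using 1
    field_simp
    ring
  intro a b hab
  have hcase : ∀ x : F, x = 0 ∨ IsPos x ∨ ∃ y, IsPos y ∧ x = -y := by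
    intro x
    by_cases hx : x = 0
    · exact Or.inl hx
    · exact Or.inr ((htri x hx).imp id fun hp => ⟨-x, hp, (neg_neg x).symm⟩)
  rcases hcase a with rfl | ha | ⟨a, ha, rfl⟩ <;> rcases hcase b with rfl | hb | ⟨b, hb, rfl⟩
  · rfl
  · exact absurd (hab.symm.trans h0) (h.isPos hb).ne_zero
  · rw [h0, hodd b hb] at hab
    exact absurd (neg_eq_zero.1 hab.symm) (h.isPos hb).ne_zero
  · exact absurd (hab.trans h0) (h.isPos ha).ne_zero
  · exact hinj a b ha hb hab
  · rw [hodd b hb] at hab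
    exact absurd (hab ▸ h.isPos ha) (hnp (h.isPos hb))
  · rw [h0, hodd a ha] at hab
    exact absurd (neg_eq_zero.1 hab) (h.isPos ha).ne_zero
  · rw [hodd a ha] at hab
    exact absurd (hab.symm ▸ h.isPos hb) (hnp (h.isPos ha))
  · rw [hodd a ha, hodd b hb] at hab
    rw [hinj a b ha hb (neg_injective hab)]

theorem PreservesPosThree.exists_ringHom (h : PreservesPosThree f) (h1 : f 1 = 1) :
    ∃ φ : F →+* F, ∀ x, f x = φ x := by
  by_cases h2 : (2 : F) = 0
  · exact h.exists_ringHom_of_two_eq_zero h2 h1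
  have hinj : Function.Injective f := by
    by_cases hneg : IsPos (-1 : F)
    · exact h.injective_of_isPos_neg_one h2 h1 hneg
    · exact h.injective_of_not_isPos_neg_one h2 h1 hneg
  have h0 := h.map_zero_of_injOn h1 fun _ _ _ _ hab => hinj hab
  exact h.exists_ringHom_of_injective h2 h0 h1 hinj

end Preservers

/-- over any finite field `F = 𝔽_{p^k}` and for any fixed `n ≥ 3`,
`f` preserves positivity on `M_n(F)` iff `f` is a positive multiple of a field
automorphism of `F`. -/
theorem stmt6 {F : Type*} [Field F] [Fintype F] (p k : ℕ) (hp : p.Prime)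
    (hcard : Fintype.card F = p ^ k) (n : ℕ) (hn : 3 ≤ n) (f : F → F) :
    PreservesPos n f ↔
      ∃ (c : F) (ℓ : ℕ), IsPos c ∧ ℓ ≤ k - 1 ∧ ∀ x : F, f x = c * x ^ p ^ ℓ := by
  constructor
  · intro h
    have h3 := (h.of_le hn).three
    have hf1 : IsPos (f 1) := h3.isPos isPos_one
    obtain ⟨φ, hφ⟩ := h3.div.exists_ringHom (div_self hf1.ne_zero)
    obtain ⟨ℓ, hℓ, hℓφ⟩ := exists_frobenius_pow_of_ringHom hp hcard φ
    refine ⟨f 1, ℓ, hf1, hℓ, fun x => ?_⟩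
    rw [← hℓφ, ← hφ, mul_div_cancel₀ _ hf1.ne_zero]
  · rintro ⟨c, ℓ, hc, -, hf⟩
    have : Fact p.Prime := ⟨hp⟩
    have : CharP F p := charP_of_card_eq_prime_pow hcard
    have hfφ : f = fun x => c * iterateFrobenius F p ℓ x := by
      funext x
      rw [hf, iterateFrobenius_def]
    rw [hfφ]
    exact preservesPos_mul_ringHom n hc _
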